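/- Let M be a d×d real-valued expansive matrix, N := (M^T)^{-1}, and let Φ={φ^1,…,φ^r}, Φ̃={φ̃^1,…,φ̃^r}, Ψ={ψ^1,…,ψ^s}, Ψ̃={ψ̃^1,…,ψ̃^s} be finite subsets of locally square-integrable functions on ℝ^d. Then the following are equivalent: (i) (FWS_J(Φ;Ψ), FWS_J(Φ̃;Ψ̃)) is a pair of frequency-based nonhomogeneous dual N-wavelet frames in D'(ℝ^d) for some integer J; (ii) the same holds for all integers J; (iii) for all compactly supported C^∞ functions f,g: lim_{j→+∞} Σ_{ℓ=1}^r Σ_{k∈ℤ^d} ⟨f, φ^ℓ_{N^j;0,k}⟩⟨φ̃^ℓ_{N^j;0,k}, g⟩ = (2π)^d⟨f,g⟩ and Σ_{ℓ=1}^r Σ_k ⟨f, φ^ℓ_{I;0,k}⟩⟨φ̃^ℓ_{I;0,k}, g⟩ + Σ_{ℓ=1}^s Σ_k ⟨f, ψ^ℓ_{I;0,k}⟩⟨ψ̃^ℓ_{I;0,k}, g⟩ = Σ_{ℓ=1}^r Σ_k ⟨f, φ^ℓ_{N;0,k}⟩⟨φ̃^ℓ_{N;0,k}, g⟩; (iv)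 lim_{j→+∞} Σ_{ℓ=1}^r \overline{φ^ℓ(N^j·)} φ̃^ℓ(N^j·) = 1 in the sense of distributions, and I^k_Φ(ξ) + I^k_Ψ(ξ) = I^{Nk}_Φ(Nξ) for a.e. ξ ∈ ℝ^d and all k ∈ ℤ^d ∪ N^{-1}ℤ^d. -/

import Mathlib

open MeasureTheory Filter Complex Topology
open scoped Real

noncomputable section

/-- Complex-valued functions on `ℝ^d`. -/
abbrev CF (d : ℕ) := (Fin d → ℝ) → ℂ

/-- An integer vector regarded as a real vector. -/
def iv {d : ℕ} (k : Fin d → ℤ) : Fin d → ℝ := fun i => (k i : ℝ)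

/-- `f_{U;k}(x) = |det U|^{1/2} f(Ux - k)`. -/
def wdil {d : ℕ} (U : Matrix (Fin d) (Fin d) ℝ) (k : Fin d → ℤ) (f : CF d) : CF d :=
  fun x => (Real.sqrt |U.det| : ℂ) * f (U.mulVec x - iv k)

/-- The `L²` inner product `⟨f,g⟩ = ∫ f · conj g`. -/
def ip {d : ℕ} (f g : CF d) : ℂ := ∫ x, f x * (starRingEnd ℂ) (g x)

/-- The squared `L²` norm. -/
def nsq {d : ℕ} (f : CF d) : ℝ := ∫ x, ‖f x‖ ^ 2

/-- All complex eigenvalues have modulus greater than one. -/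
def Expansive {d : ℕ} (M : Matrix (Fin d) (Fin d) ℝ) : Prop :=
  ∀ μ ∈ spectrum ℂ (M.map (Complex.ofReal : ℝ → ℂ)), 1 < ‖μ‖

/-- Real dot product on `ℝ^d`. -/
def dotR {d : ℕ} (x y : Fin d → ℝ) : ℝ := ∑ i, x i * y i

/-- The frequency-based dilation `h_{U;0,k}(x) = |det U|^{1/2} e^{-i k·Ux} h(Ux)`. -/
def fdil {d : ℕ} (U : Matrix (Fin d) (Fin d) ℝ) (k : Fin d → ℤ) (f : CF d) : CF d :=
  fun x => (Real.sqrt |U.det| : ℂ) *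
    Complex.exp (-Complex.I * (dotR (iv k) (U.mulVec x) : ℝ)) * f (U.mulVec x)

/-- `f` is locally square integrable on `ℝ^d`. -/
def LocL2 {d : ℕ} (f : CF d) : Prop :=
  ∀ K : Set (Fin d → ℝ), IsCompact K → MemLp f 2 (volume.restrict K)

/-- `f` is a compactly supported `C^∞` test function. -/
def IsTest {d : ℕ} (f : CF d) : Prop := ContDiff ℝ (⊤ : ℕ∞) f ∧ HasCompactSupport f

/-- `(FWS_J(Φ;{Ψ_j}), FWS_J(Φ̃;{Ψ̃_j}))` is a pair of frequency-based nonstationary dual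
wavelet frames in the distribution space `D'(ℝ^d)`: for all test functions `f, g`, all the
level-wise series converge absolutely, and the partial sums up to level `J'-1` converge to
`(2π)^d ⟨f,g⟩` as `J' → +∞`. -/
def DualDistr {d : ℕ} (N : ℤ → Matrix (Fin d) (Fin d) ℝ) (J : ℤ)
    {ιΦ : Type} (Φ Φt : ιΦ → CF d)
    {ι : ℤ → Type} (Ψ Ψt : (j : ℤ) → ι j → CF d) : Prop :=
  ∀ f g : CF d, IsTest f → IsTest g →
    Summable (fun p : ιΦ × (Fin d → ℤ) =>
      ip f (fdil (N J) p.2 (Φ p.1)) * ip (fdil (N J) p.2 (Φt p.1)) g) ∧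
    (∀ j : ℤ, J ≤ j → Summable (fun p : ι j × (Fin d → ℤ) =>
      ip f (fdil (N j) p.2 (Ψ j p.1)) * ip (fdil (N j) p.2 (Ψt j p.1)) g)) ∧
    Tendsto (fun n : ℕ =>
        (∑' p : ιΦ × (Fin d → ℤ),
          ip f (fdil (N J) p.2 (Φ p.1)) * ip (fdil (N J) p.2 (Φt p.1)) g)
        + ∑ m ∈ Finset.range n, ∑' p : ι (J + (m : ℤ)) × (Fin d → ℤ),
            ip f (fdil (N (J + (m : ℤ))) p.2 (Ψ (J + (m : ℤ)) p.1)) *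
              ip (fdil (N (J + (m : ℤ))) p.2 (Ψt (J + (m : ℤ)) p.1)) g)
      atTop (𝓝 ((((2 * π) ^ d : ℝ) : ℂ) * ip f g))

/-- The frame sum of the frequency-based nonstationary system `FWS_J(Φ;{Ψ_j})`. -/
def nsSum {d : ℕ} (N : ℤ → Matrix (Fin d) (Fin d) ℝ) (J : ℤ)
    {ιΦ : Type} (Φ : ιΦ → CF d) {ι : ℤ → Type} (Ψ : (j : ℤ) → ι j → CF d)
    (f : CF d) : ℝ :=
  (∑' p : ιΦ × (Fin d → ℤ), ‖ip f (fdil (N J) p.2 (Φ p.1))‖ ^ 2)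
    + ∑' (n : ℕ), ∑' p : ι (J + (n : ℤ)) × (Fin d → ℤ),
        ‖ip f (fdil (N (J + (n : ℤ))) p.2 (Ψ (J + (n : ℤ)) p.1))‖ ^ 2

open scoped Classical in
/-- The bracket product `I^k_Φ(ξ) = Σ_ℓ conj(φ^ℓ(ξ)) φ̃^ℓ(ξ+2πk)` for `k ∈ ℤ^d`,
defined to be `0` for `k ∈ ℝ^d ∖ ℤ^d`. -/
def Ipair {d : ℕ} {ι : Type} [Fintype ι] (φ φt : ι → CF d)
    (k : Fin d → ℝ) (ξ : Fin d → ℝ) : ℂ :=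
  if ∀ i, ∃ m : ℤ, k i = (m : ℝ) then
    ∑ ℓ, (starRingEnd ℂ) (φ ℓ ξ) * φt ℓ (ξ + (2 * π) • k)
  else 0

section TorusParseval

local instance : MeasureSpace UnitAddCircle := ⟨AddCircle.haarAddCircle⟩

local instance : Measure.IsAddHaarMeasure (volume : Measure UnitAddCircle) :=
  inferInstanceAs (Measure.IsAddHaarMeasure AddCircle.haarAddCircle)

local instance : IsProbabilityMeasure (volume : Measure UnitAddCircle) :=
  inferInstanceAs (IsProbabilityMeasure AddCircle.haarAddCircle)

/-- unit cube -/
def QQ (d : ℕ) : Set (Fin d → ℝ) := {x | ∀ i, x i ∈ Set.Ioc (0:ℝ) (0 + 1)}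

/-- exponential -/
def ee {d : ℕ} (k : Fin d → ℤ) (t : Fin d → ℝ) : ℂ :=
  Complex.exp (2 * π * Complex.I * (dotR (iv k) t : ℝ))

lemma QQ_meas (d : ℕ) : MeasurableSet (QQ d) := 
  MeasurableSet.univ_pi' (fun i => measurableSet_Ioc)

/-- section of the torus projection -/
def rho (d : ℕ) (x : UnitAddTorus (Fin d)) : Fin d → ℝ :=
  (UnitAddTorus.measurableEquivPiIoc (0 : Fin d → ℝ) x).1

lemma rho_mp (d : ℕ) : MeasurePreserving (rho d) volume (volume.restrict (QQ d)) := by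
  have h1 := UnitAddTorus.measurePreserving_equivPiIoc (0 : Fin d → ℝ)
  have h2 : MeasurePreserving (Subtype.val : {x : Fin d → ℝ // ∀ i, x i ∈ Set.Ioc ((0 : Fin d → ℝ) i) ((0 : Fin d → ℝ) i + 1)} → _)
     (Measure.comap Subtype.val volume) (volume.restrict (QQ d)) :=
    ⟨measurable_subtype_coe, map_comap_subtype_coe (QQ_meas d) volume⟩
  exact h2.comp h1

lemma rho_emb (d : ℕ) : MeasurableEmbedding (rho d) :=
  (MeasurableEmbedding.subtype_coe (QQ_meas d)).comp
    (UnitAddTorus.measurableEquivPiIoc (0 : Fin d → ℝ)).measurableEmbedding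

lemma ee_rho {d : ℕ} (k : Fin d → ℤ) (x : UnitAddTorus (Fin d)) :
    ee k (rho d x) = UnitAddTorus.mFourier k x := by
  have hx : x = fun i => ((rho d x i : ℝ) : UnitAddCircle) :=
    ((UnitAddTorus.measurableEquivPiIoc (0 : Fin d → ℝ)).symm_apply_apply x).symm
  conv_rhs => rw [hx]
  simp only [UnitAddTorus.mFourier, ContinuousMap.coe_mk, fourier_coe_apply, ← Complex.exp_sum, ee, dotR, iv]
  congr 1
  push_cast
  rw [Finset.mul_sum]
  refine Finset.sum_congr rfl fun i _ => ?_
  ring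

lemma parseval_Q {d : ℕ} (a b : CF d) (ha : MemLp a 2 (volume.restrict (QQ d)))
    (hb : MemLp b 2 (volume.restrict (QQ d))) :
    HasSum (fun k : Fin d → ℤ => (∫ t in QQ d, a t * ee k t) * 
        (starRingEnd ℂ) (∫ t in QQ d, b t * ee k t))
      (∫ t in QQ d, a t * (starRingEnd ℂ) (b t)) := by
  have ha' : MemLp (a ∘ rho d) 2 volume := ha.comp_measurePreserving (rho_mp d)
  have hb' : MemLp (b ∘ rho d) 2 volume := hb.comp_measurePreserving (rho_mp d)
  have key := UnitAddTorus.hasSum_prod_mFourierCoeff (hb'.toLp) (ha'.toLp)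
  have h1 : ∀ (c : CF d) (hc : MemLp (c ∘ rho d) 2 volume) (k : Fin d → ℤ),
      UnitAddTorus.mFourierCoeff (hc.toLp) k = ∫ t in QQ d, c t * ee (-k) t := by
    intro c hc k
    rw [← (rho_mp d).integral_comp (rho_emb d)]
    unfold UnitAddTorus.mFourierCoeff
    refine integral_congr_ae ?_
    filter_upwards [hc.coeFn_toLp] with x hx
    rw [hx, ee_rho, smul_eq_mul, mul_comm]; rfl
  have h2 : ∫ t, (starRingEnd ℂ) (hb'.toLp (b ∘ rho d) t) * (ha'.toLp (a ∘ rho d) t)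
      = ∫ t in QQ d, a t * (starRingEnd ℂ) (b t) := by
    rw [← (rho_mp d).integral_comp (rho_emb d)]
    refine integral_congr_ae ?_
    filter_upwards [ha'.coeFn_toLp, hb'.coeFn_toLp] with x hx hx'
    rw [hx, hx', mul_comm]; rfl
  rw [h2] at key
  simp only [h1] at key
  have := (Equiv.neg (Fin d → ℤ)).hasSum_iff.mpr key
  refine this.congr_fun ?_
  intro k
  simp [mul_comm]

end TorusParseval

lemma hasSum_cubes {d : ℕ} (H : CF d) (hH : Integrable H) :
    HasSum (fun k : Fin d → ℤ => ∫ t in QQ d, H (t + iv k)) (∫ t, H t) := by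
  have hs : ∀ k : Fin d → ℤ, MeasurableSet {x : Fin d → ℝ | x - iv k ∈ QQ d} := fun k =>
    (QQ_meas d).preimage (by fun_prop)
  have h := hasSum_integral_iUnion (μ := volume) (f := H) hs ?_ hH.integrableOn
  · have hu : (⋃ k : Fin d → ℤ, {x : Fin d → ℝ | x - iv k ∈ QQ d}) = Set.univ := by
      refine Set.eq_univ_of_forall fun x => Set.mem_iUnion.mpr ⟨fun i => ⌈x i⌉ - 1, ?_⟩
      intro i
      have h1 := Int.ceil_lt_add_one (x i)
      have h2 := Int.le_ceil (x i)
      simp only [Pi.sub_apply, iv, Set.mem_Ioc]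
      push_cast
      constructor <;> linarith
    rw [hu, setIntegral_univ] at h
    refine h.congr_fun fun k => ?_
    have := (measurePreserving_add_right volume (iv k)).setIntegral_preimage_emb
      (measurableEmbedding_addRight _) H {x : Fin d → ℝ | x - iv k ∈ QQ d}
    rw [← this]
    congr 2
    ext x
    simp
  · intro k l hkl
    refine Set.disjoint_left.mpr fun x hx hy => hkl ?_
    ext i
    have h1 := hx i
    have h2 := hy i
    simp only [Pi.sub_apply, iv, Set.mem_Ioc] at h1 h2
    have h3 : (k i : ℝ) < l i + 1 := by linarith
    have h4 : (l i : ℝ) < k i + 1 := by linarith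
    have h5 : k i < l i + 1 := by exact_mod_cast h3
    have h6 : l i < k i + 1 := by exact_mod_cast h4
    omega

lemma exists_S {d : ℕ} (K : Set (Fin d → ℝ)) (hK : IsCompact K) :
    ∃ S : Finset (Fin d → ℤ), ∀ k ∉ S, ∀ t ∈ QQ d, t + iv k ∉ K := by
  obtain ⟨R, hR⟩ := hK.isBounded.exists_norm_le
  obtain ⟨n, hn⟩ := exists_nat_ge (R + 1)
  refine ⟨Finset.Icc (fun _ => -(n : ℤ)) (fun _ => (n : ℤ)), fun k hk t ht hm => hk ?_⟩
  rw [Finset.mem_Icc]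
  have h1 : ∀ i, |t i + k i| ≤ R := fun i => (norm_le_pi_norm (t + iv k) i).trans (hR _ hm)
  constructor <;> intro i <;> have h2 := abs_le.mp (h1 i) <;> have h3 := ht i <;>
    simp only [Set.mem_Ioc] at h3
  · have : (-(n : ℤ) : ℝ) ≤ k i := by push_cast; linarith
    exact_mod_cast this
  · have : (k i : ℝ) ≤ n := by linarith
    exact_mod_cast this

lemma integrable_of_L2 {d : ℕ} {F : CF d} {K : Set (Fin d → ℝ)} (hK : IsCompact K)
    (hF : MemLp F 2 volume) (h0 : ∀ x ∉ K, F x = 0) : Integrable F := by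
  rw [← integrableOn_iff_integrable_of_support_subset (s := K)]
  · have : IsFiniteMeasure (volume.restrict K) := ⟨by simpa using hK.measure_lt_top⟩
    exact (hF.restrict K).integrable (by norm_num)
  · intro x hx
    by_contra h
    exact hx (h0 x h)

lemma ee_cont {d : ℕ} (k : Fin d → ℤ) : Continuous (ee (d := d) k) := by
  unfold ee dotR; fun_prop

lemma ee_norm {d : ℕ} (k : Fin d → ℤ) (t : Fin d → ℝ) : ‖ee k t‖ = 1 := by
  unfold ee
  have : (2 * π * Complex.I * (dotR (iv k) t : ℝ) : ℂ) = ((2 * π * dotR (iv k) t : ℝ) : ℂ) * Complex.I := by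
    push_cast; ring
  rw [this, Complex.norm_exp_ofReal_mul_I]

lemma ee_add {d : ℕ} (k m : Fin d → ℤ) (t : Fin d → ℝ) : ee k (t + iv m) = ee k t := by
  unfold ee
  rw [Complex.exp_eq_exp_iff_exists_int]
  refine ⟨∑ i, k i * m i, ?_⟩
  simp only [dotR, iv, Pi.add_apply, mul_add, Finset.sum_add_distrib]
  push_cast
  ring

lemma parseval_R {d : ℕ} (F G : CF d) (hF : MemLp F 2 volume) (hG : MemLp G 2 volume)
    (K : Set (Fin d → ℝ)) (hK : IsCompact K) (hF0 : ∀ x ∉ K, F x = 0) (hG0 : ∀ x ∉ K, G x = 0) :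
    HasSum (fun k : Fin d → ℤ => (∫ t, F t * ee k t) * (starRingEnd ℂ) (∫ t, G t * ee k t))
      (∑' k : Fin d → ℤ, ∫ t, F t * (starRingEnd ℂ) (G (t + iv k))) := by
  obtain ⟨S, hS⟩ := exists_S K hK
  have hsum : ∀ H : CF d, Integrable H → (∀ x ∉ K, H x = 0) →
      ∫ t, H t = ∑ m ∈ S, ∫ t in QQ d, H (t + iv m) := by
    intro H hH hH0
    refine (hasSum_cubes H hH).unique (hasSum_sum_of_ne_finset_zero ?_)
    intro m hm
    rw [setIntegral_congr_fun (g := fun _ => 0) (QQ_meas d)]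
    · simp
    · intro t ht
      exact hH0 _ (hS m hm t ht)
  have hsh : ∀ H : CF d, MemLp H 2 volume → ∀ m : Fin d → ℤ, 
      MemLp (fun t => H (t + iv m)) 2 volume := fun H hH m =>
    hH.comp_measurePreserving (measurePreserving_add_right volume (iv m))
  have hper : ∀ H : CF d, MemLp H 2 volume → 
      MemLp (fun t => ∑ m ∈ S, H (t + iv m)) 2 (volume.restrict (QQ d)) := fun H hH =>
    memLp_finsetSum S (fun m _ => (hsh H hH m).restrict _)
  have hfin : IsFiniteMeasure (volume.restrict (QQ d)) := by
    refine ⟨?_⟩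
    rw [Measure.restrict_apply_univ]
    refine lt_of_le_of_lt (measure_mono (t := Set.Icc 0 1) ?_) (isCompact_Icc.measure_lt_top)
    intro x hx
    exact ⟨fun i => (hx i).1.le, fun i => by simpa using (hx i).2⟩
  have hft : ∀ H : CF d, MemLp H 2 volume → (∀ x ∉ K, H x = 0) → ∀ k : Fin d → ℤ,
      ∫ t, H t * ee k t = ∫ t in QQ d, (∑ m ∈ S, H (t + iv m)) * ee k t := by
    intro H hH hH0 k
    have hint : Integrable (fun t => H t * ee k t) :=
      (integrable_of_L2 hK hH hH0).mul_bdd (c := 1) (ee_cont k).aestronglyMeasurable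
        (Eventually.of_forall fun t => (ee_norm k t).le)
    rw [hsum _ hint (fun x hx => by rw [hH0 x hx, zero_mul])]
    simp only [Finset.sum_mul]
    rw [integral_finsetSum]
    · simp only [ee_add]
    · intro m _
      refine Integrable.mul_bdd (c := 1) ?_ (ee_cont k).aestronglyMeasurable
        (Eventually.of_forall fun t => (ee_norm k t).le)
      exact ((hsh H hH m).restrict _).integrable (by norm_num)
  have key := parseval_Q _ _ (hper F hF) (hper G hG)
  simp only [← hft F hF hF0, ← hft G hG hG0] at key
  convert key using 1
  have hprod : ∀ m l : Fin d → ℤ, Integrable (fun t => F (t + iv m) * (starRingEnd ℂ) (G (t + iv l))) := by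
    intro m l
    exact MemLp.integrable_mul (p := 2) (q := 2) (hsh F hF m) (hsh G hG l).star
  have hR : ∫ t in QQ d, (∑ m ∈ S, F (t + iv m)) * (starRingEnd ℂ) (∑ m ∈ S, G (t + iv m))
      = ∑ m ∈ S, ∑ l ∈ S, ∫ t in QQ d, F (t + iv m) * (starRingEnd ℂ) (G (t + iv l)) := by
    simp only [map_sum, Finset.sum_mul_sum]
    rw [integral_finsetSum _ (fun m _ => integrable_finsetSum _ fun l _ => (hprod m l).restrict)]
    refine Finset.sum_congr rfl fun m _ => ?_
    rw [integral_finsetSum _ (fun l _ => (hprod m l).restrict)]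
  rw [hR]
  have hiv : ∀ m k : Fin d → ℤ, iv (m + k) = iv m + iv k := by
    intro m k; ext i; simp [iv]
  have hin : ∀ k : Fin d → ℤ, ∫ t, F t * (starRingEnd ℂ) (G (t + iv k)) = 
      ∑ m ∈ S, ∫ t in QQ d, F (t + iv m) * (starRingEnd ℂ) (G (t + iv (m + k))) := by
    intro k
    rw [hsum]
    · simp only [hiv, add_assoc]
    · have := hprod 0 k
      have h0 : iv (0 : Fin d → ℤ) = 0 := by ext i; simp [iv]
      simpa only [h0, add_zero] using this
    · intro x hx
      rw [hF0 x hx, zero_mul]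
  simp only [hin]
  have hz : ∀ m : Fin d → ℤ, HasSum (fun l => ∫ t in QQ d, F (t + iv m) * (starRingEnd ℂ) (G (t + iv l)))
      (∑ l ∈ S, ∫ t in QQ d, F (t + iv m) * (starRingEnd ℂ) (G (t + iv l))) := by
    intro m
    refine hasSum_sum_of_ne_finset_zero ?_
    intro l hl
    rw [setIntegral_congr_fun (g := fun _ => 0) (QQ_meas d)]
    · simp
    · intro t ht
      simp [hG0 _ (hS l hl t ht)]
  refine HasSum.tsum_eq (hasSum_sum fun m _ => ?_)
  exact (Equiv.addLeft m).hasSum_iff.mpr (hz m)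

lemma mulVec_emb {d : ℕ} {V : Matrix (Fin d) (Fin d) ℝ} (hV : V.det ≠ 0) :
    IsHomeomorph (fun t : Fin d → ℝ => V.mulVec t) := by
  have hu : IsUnit V.det := isUnit_iff_ne_zero.mpr hV
  exact (Homeomorph.mk ⟨fun t => V.mulVec t, fun t => V⁻¹.mulVec t,
    fun t => by simp [Matrix.mulVec_mulVec, Matrix.nonsing_inv_mul V hu], 
    fun t => by simp [Matrix.mulVec_mulVec, Matrix.mul_nonsing_inv V hu]⟩
    (by fun_prop) (by fun_prop)).isHomeomorph

lemma map_mulVec {d : ℕ} {V : Matrix (Fin d) (Fin d) ℝ} (hV : V.det ≠ 0) :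
    Measure.map (fun t : Fin d → ℝ => V.mulVec t) volume = ENNReal.ofReal |V.det⁻¹| • volume := by
  have := Real.map_matrix_volume_pi_eq_smul_volume_pi hV
  exact this

lemma integral_comp_mulVec {d : ℕ} {V : Matrix (Fin d) (Fin d) ℝ} (hV : V.det ≠ 0) (h : CF d) :
    ∫ t, h (V.mulVec t) = ((|V.det|⁻¹ : ℝ) : ℂ) * ∫ x, h x := by
  have h1 := (mulVec_emb hV).isClosedEmbedding.measurableEmbedding.integral_map (μ := volume) h
  rw [← h1, map_mulVec hV, integral_smul_measure, ENNReal.toReal_ofReal (abs_nonneg _), abs_inv]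
  simp

lemma LocL2.comp_affine {d : ℕ} {φ : CF d} (hφ : LocL2 φ) {A : Matrix (Fin d) (Fin d) ℝ}
    (hA : A.det ≠ 0) (b : Fin d → ℝ) : LocL2 (fun x => φ (A.mulVec x + b)) := by
  intro K hK
  set T : (Fin d → ℝ) → (Fin d → ℝ) := fun x => A.mulVec x + b with hT
  have hTh : IsHomeomorph T := (Homeomorph.addRight b).isHomeomorph.comp (mulVec_emb hA)
  have hTe : MeasurableEmbedding T := hTh.isClosedEmbedding.measurableEmbedding
  have hmap : Measure.map T volume = ENNReal.ofReal |A.det⁻¹| • volume := by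
    have : T = (fun x => x + b) ∘ (fun x => A.mulVec x) := rfl
    rw [this, ← Measure.map_map (by fun_prop) (mulVec_emb hA).continuous.measurable, map_mulVec hA,
      Measure.map_smul, map_add_right_eq_self]
  have h1 : Measure.map T (volume.restrict K) = 
      ENNReal.ofReal |A.det⁻¹| • volume.restrict (T '' K) := by
    have := hTe.restrict_map volume (T '' K)
    rw [Set.preimage_image_eq _ hTh.injective] at this
    rw [← this, hmap, Measure.restrict_smul]
  have h2 := (hφ (T '' K) (hK.image hTh.continuous)).smul_measure (c := ENNReal.ofReal |A.det⁻¹|) (by simp)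
  rw [← h1] at h2
  exact hTe.memLp_map_measure_iff.mp h2

lemma LocL2.conj {d : ℕ} {φ : CF d} (hφ : LocL2 φ) : LocL2 (fun x => (starRingEnd ℂ) (φ x)) :=
  fun K hK => (hφ K hK).star

lemma LocL2.mul_cpt {d : ℕ} {φ f : CF d} (hφ : LocL2 φ) (hf : Continuous f) (hc : HasCompactSupport f) :
    MemLp (fun x => f x * φ x) 2 volume := by
  have h1 : MemLp f ⊤ (volume.restrict (tsupport f)) := 
    (hf.memLp_top_of_hasCompactSupport hc volume).restrict _
  have h2 : MemLp (f * φ) 2 (volume.restrict (tsupport f)) := (hφ _ hc).mul h1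
  have h3 := (memLp_indicator_iff_restrict (isClosed_tsupport f).measurableSet).mpr h2
  suffices heq : (fun x => f x * φ x) = (tsupport f).indicator (f * φ) by rw [heq]; exact h3
  funext x
  by_cases hx : x ∈ tsupport f
  · simp [hx]
  · simp [hx, image_eq_zero_of_notMem_tsupport hx]

lemma IsTest.comp_mulVec {d : ℕ} {f : CF d} (hf : IsTest f) {V : Matrix (Fin d) (Fin d) ℝ}
    (hV : V.det ≠ 0) : IsTest (fun x => f (V.mulVec x)) := by
  refine ⟨?_, ?_⟩
  · exact hf.1.comp (Matrix.mulVecLin V).toContinuousLinearMap.contDiff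
  · exact hf.2.comp_isClosedEmbedding (mulVec_emb hV).isClosedEmbedding

/-- frequency side term -/
def brk {d : ℕ} (U : Matrix (Fin d) (Fin d) ℝ) (φ φt f g : CF d) (k : Fin d → ℤ) : ℂ :=
  ∫ x, f x * (starRingEnd ℂ) (g (x + (2 * π) • (U⁻¹.mulVec (iv k)))) *
    ((starRingEnd ℂ) (φ (U.mulVec x)) * φt (U.mulVec x + (2 * π) • iv k))

lemma ip_fdil {d : ℕ} (U : Matrix (Fin d) (Fin d) ℝ) (hU : U.det ≠ 0) (φ f : CF d) (k : Fin d → ℤ)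
    (V : Matrix (Fin d) (Fin d) ℝ) (hV : V = (2 * π) • U⁻¹) (hVd : V.det ≠ 0) :
    ip f (fdil U k φ) = ((|V.det| * Real.sqrt |U.det| : ℝ) : ℂ) *
      ∫ t, (f (V.mulVec t) * (starRingEnd ℂ) (φ ((2 * π) • t))) * ee k t := by
  have h := integral_comp_mulVec hVd (fun x => f x * (starRingEnd ℂ) (fdil U k φ x))
  have hu : IsUnit U.det := isUnit_iff_ne_zero.mpr hU
  have hUV : ∀ t, U.mulVec (V.mulVec t) = (2 * π) • t := by
    intro t
    rw [Matrix.mulVec_mulVec, hV, Matrix.mul_smul, Matrix.mul_nonsing_inv U hu, Matrix.smul_mulVec,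
      Matrix.one_mulVec]
  have h2 : ip f (fdil U k φ) = ((|V.det| : ℝ) : ℂ) * 
      ∫ t, f (V.mulVec t) * (starRingEnd ℂ) (fdil U k φ (V.mulVec t)) := by
    rw [h, ← mul_assoc, ← Complex.ofReal_mul, mul_inv_cancel₀ (abs_ne_zero.mpr hVd)]
    simp [ip]
  rw [h2, Complex.ofReal_mul, mul_assoc, ← integral_const_mul (Real.sqrt |U.det| : ℂ)]
  congr 2
  ext t
  simp only [fdil, hUV, map_mul, Complex.conj_ofReal, ← Complex.exp_conj, ee, map_neg, Complex.conj_I, neg_neg]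
  have : (Complex.I * (dotR (iv k) ((2 * π) • t) : ℝ)) = 
      2 * π * Complex.I * (dotR (iv k) t : ℝ) := by
    have h3 : dotR (iv k) ((2 * π) • t) = (2 * π) * dotR (iv k) t := by
      simp only [dotR, Pi.smul_apply, smul_eq_mul, Finset.mul_sum]
      exact Finset.sum_congr rfl fun i _ => by ring
    rw [h3]
    push_cast; ring
  rw [this]
  ring

lemma ip_conj {d : ℕ} (f g : CF d) : ip f g = (starRingEnd ℂ) (ip g f) := by
  unfold ip
  rw [← integral_conj]
  congr 1; ext x; simp [mul_comm]

lemma key1 {d : ℕ} (U : Matrix (Fin d) (Fin d) ℝ) (hU : U.det ≠ 0) (φ φt f g : CF d)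
    (hφ : LocL2 φ) (hφt : LocL2 φt) (hf : IsTest f) (hg : IsTest g) :
    HasSum (fun k : Fin d → ℤ => ip f (fdil U k φ) * ip (fdil U k φt) g)
      ((((2 * π) ^ d : ℝ) : ℂ) * ∑' k : Fin d → ℤ, brk U φ φt f g k) := by
  obtain ⟨V, hV⟩ : ∃ V, V = (2 * π) • U⁻¹ := ⟨_, rfl⟩
  have hu : IsUnit U.det := isUnit_iff_ne_zero.mpr hU
  have hUV : ∀ t, U.mulVec (V.mulVec t) = (2 * π) • t := by
    intro t
    rw [Matrix.mulVec_mulVec, hV, Matrix.mul_smul, Matrix.mul_nonsing_inv U hu, Matrix.smul_mulVec,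
      Matrix.one_mulVec]
  have hdet : V.det = (2 * π) ^ d * U.det⁻¹ := by
    rw [hV, Matrix.det_smul, Fintype.card_fin, Matrix.det_nonsing_inv, Ring.inverse_eq_inv']
  have h2pi : (0 : ℝ) < (2 * π) ^ d := by positivity
  have hVd : V.det ≠ 0 := by rw [hdet]; positivity
  have hconst : ((2 * π) ^ d * |V.det|) = (|V.det| * Real.sqrt |U.det|) * (|V.det| * Real.sqrt |U.det|) := by
    have : (|V.det| * Real.sqrt |U.det|) * (|V.det| * Real.sqrt |U.det|) = |V.det| * (|V.det| * |U.det|) := by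
      rw [mul_mul_mul_comm, Real.mul_self_sqrt (abs_nonneg _)]; ring
    rw [this, ← abs_mul V.det U.det, hdet, mul_assoc, inv_mul_cancel₀ hU, mul_one, abs_of_pos h2pi]
    ring
  have hL : ∀ f φ : CF d, IsTest f → LocL2 φ → 
      MemLp (fun t => f (V.mulVec t) * (starRingEnd ℂ) (φ ((2 * π) • t))) 2 volume := by
    intro f φ hf hφ
    have h1 := hφ.comp_affine (A := (2 * π) • (1 : Matrix (Fin d) (Fin d) ℝ)) 
      (by rw [Matrix.det_smul]; simp) 0
    simp only [Matrix.smul_mulVec, Matrix.one_mulVec, add_zero] at h1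
    exact h1.conj.mul_cpt (hf.comp_mulVec hVd).1.continuous (hf.comp_mulVec hVd).2
  have key := parseval_R _ _ (hL f φ hf hφ) (hL g φt hg hφt) 
    (tsupport (fun x => f (V.mulVec x)) ∪ tsupport (fun x => g (V.mulVec x)))
    (IsCompact.union (hf.comp_mulVec hVd).2 (hg.comp_mulVec hVd).2)
    (fun x hx => by
      have := image_eq_zero_of_notMem_tsupport (fun h => hx (Or.inl h))
      beta_reduce at this
      rw [this, zero_mul])
    (fun x hx => by
      have := image_eq_zero_of_notMem_tsupport (fun h => hx (Or.inr h))
      beta_reduce at this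
      rw [this, zero_mul])
  have key2 := key.mul_left (((2 * π) ^ d * |V.det| : ℝ) : ℂ)
  have hb : ∀ k : Fin d → ℤ, brk U φ φt f g k = ((|V.det| : ℝ) : ℂ) *
      ∫ t, f (V.mulVec t) * (starRingEnd ℂ) (φ ((2 * π) • t)) * 
        (starRingEnd ℂ) (g (V.mulVec (t + iv k)) * (starRingEnd ℂ) (φt ((2 * π) • (t + iv k)))) := by
    intro k
    have h := integral_comp_mulVec hVd (fun x => f x * (starRingEnd ℂ) (g (x + (2 * π) • (U⁻¹.mulVec (iv k)))) *
    ((starRingEnd ℂ) (φ (U.mulVec x)) * φt (U.mulVec x + (2 * π) • iv k)))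
    have h2 : brk U φ φt f g k = ((|V.det| : ℝ) : ℂ) * (((|V.det|⁻¹ : ℝ) : ℂ) * brk U φ φt f g k) := by
      rw [← mul_assoc, ← Complex.ofReal_mul, mul_inv_cancel₀ (abs_ne_zero.mpr hVd)]; simp
    rw [h2]; unfold brk; rw [← h]
    congr 2
    ext t
    rw [hUV, Matrix.mulVec_add, smul_add]
    conv_rhs => rw [hV, Matrix.smul_mulVec, Matrix.smul_mulVec]
    rw [hV, Matrix.smul_mulVec]
    simp only [map_mul, Complex.conj_conj]
    ring
  suffices hh : ((((2 * π) ^ d : ℝ) : ℂ) * ∑' k : Fin d → ℤ, brk U φ φt f g k) =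
      (((2 * π) ^ d * |V.det| : ℝ) : ℂ) * ∑' k : Fin d → ℤ,
      ∫ t, f (V.mulVec t) * (starRingEnd ℂ) (φ ((2 * π) • t)) * 
        (starRingEnd ℂ) (g (V.mulVec (t + iv k)) * (starRingEnd ℂ) (φt ((2 * π) • (t + iv k)))) by
    rw [hh]
    refine key2.congr_fun fun k => ?_
    rw [ip_conj _ g, ip_fdil U hU φ f k V hV hVd, ip_fdil U hU φt g k V hV hVd, hconst]
    simp only [map_mul, Complex.conj_ofReal]
    push_cast
    ring
  simp only [hb]
  rw [tsum_mul_left]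
  push_cast
  ring

lemma LocL2.mul_li {d : ℕ} {a b : CF d} (ha : LocL2 a) (hb : LocL2 b) :
    LocallyIntegrable (fun x => a x * b x) volume := by
  rw [locallyIntegrable_iff]
  intro K hK
  exact MemLp.integrable_mul (p := 2) (q := 2) (ha K hK) (hb K hK)

lemma Ipair_int {d : ℕ} {ι : Type} [Fintype ι] (φ φt : ι → CF d) (k : Fin d → ℤ) (ξ : Fin d → ℝ) :
    Ipair φ φt (iv k) ξ = ∑ ℓ, (starRingEnd ℂ) (φ ℓ ξ) * φt ℓ (ξ + (2 * π) • iv k) :=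
  if_pos (fun i => ⟨k i, rfl⟩)

lemma Ipair_not {d : ℕ} {ι : Type} [Fintype ι] (φ φt : ι → CF d) (k : Fin d → ℝ) (ξ : Fin d → ℝ)
    (hk : ∀ m : Fin d → ℤ, k ≠ iv m) : Ipair φ φt k ξ = 0 := by
  refine if_neg (fun h => ?_)
  choose m hm using h
  exact hk m (funext hm)

lemma Ipair_li {d : ℕ} {ι : Type} [Fintype ι] {φ φt : ι → CF d} (hφ : ∀ ℓ, LocL2 (φ ℓ))
    (hφt : ∀ ℓ, LocL2 (φt ℓ)) {U : Matrix (Fin d) (Fin d) ℝ} (hU : U.det ≠ 0) (κ : Fin d → ℝ) :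
    LocallyIntegrable (fun x => Ipair φ φt κ (U.mulVec x)) volume := by
  by_cases h : ∀ m : Fin d → ℤ, κ ≠ iv m
  · simp only [Ipair_not φ φt κ _ h]
    exact locallyIntegrable_zero
  · push Not at h
    obtain ⟨m, rfl⟩ := h
    simp only [Ipair_int]
    refine locallyIntegrable_finsetSum _ fun ℓ _ => ?_
    have h1 := ((hφ ℓ).comp_affine hU 0).conj
    simp only [add_zero] at h1
    exact h1.mul_li ((hφt ℓ).comp_affine hU _)

/-- the smooth weight -/
def wt {d : ℕ} (f g : CF d) (κ x : Fin d → ℝ) : ℂ :=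
  f x * (starRingEnd ℂ) (g (x + (2 * π) • κ))

lemma wt_cont {d : ℕ} {f g : CF d} (hf : IsTest f) (hg : IsTest g) (κ : Fin d → ℝ) :
    Continuous (wt f g κ) := by
  exact hf.1.continuous.mul (Complex.continuous_conj.comp (hg.1.continuous.comp (by fun_prop)))

lemma wt_cpt {d : ℕ} {f g : CF d} (hf : IsTest f) (κ : Fin d → ℝ) :
    HasCompactSupport (wt f g κ) := hf.2.mul_right

lemma wt_int {d : ℕ} {f g D : CF d} (hf : IsTest f) (hg : IsTest g) (κ : Fin d → ℝ)
    (hD : LocallyIntegrable D volume) : Integrable (fun x => wt f g κ x * D x) := 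
  hD.integrable_smul_left_of_hasCompactSupport (wt_cont hf hg κ) (wt_cpt hf κ)

/-- grouped frequency term -/
def TT {d : ℕ} (U : Matrix (Fin d) (Fin d) ℝ) {ι : Type} [Fintype ι] (φ φt : ι → CF d) (f g : CF d)
    (κ : Fin d → ℝ) : ℂ := ∫ x, wt f g κ x * Ipair φ φt (U.mulVec κ) (U.mulVec x)

lemma iv_finite {d : ℕ} (K : Set (Fin d → ℝ)) (hK : IsCompact K) :
    {k : Fin d → ℤ | iv k ∈ K}.Finite := by
  obtain ⟨R, hR⟩ := hK.isBounded.exists_norm_le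
  obtain ⟨n, hn⟩ := exists_nat_ge R
  refine (Set.finite_Icc (fun _ => -(n : ℤ)) (fun _ => (n : ℤ))).subset fun k hk => ?_
  have h1 : ∀ i, |(k i : ℝ)| ≤ R := fun i => (norm_le_pi_norm (iv k) i).trans (hR _ hk)
  constructor <;> intro i <;> have h2 := abs_le.mp (h1 i)
  · have : (-(n : ℤ) : ℝ) ≤ k i := by push_cast; linarith
    exact_mod_cast this
  · have : (k i : ℝ) ≤ n := by linarith
    exact_mod_cast this

/-- compact set containing relevant shifts -/
lemma exists_shift {d : ℕ} {f g : CF d} (hf : IsTest f) (hg : IsTest g) :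
    ∃ K : Set (Fin d → ℝ), IsCompact K ∧ ∀ κ ∉ K, ∀ x, wt f g κ x = 0 := by
  refine ⟨(fun p : (Fin d → ℝ) × (Fin d → ℝ) => (2 * π)⁻¹ • (p.2 - p.1)) '' (tsupport f ×ˢ tsupport g),
    (hf.2.isCompact.prod hg.2.isCompact).image (by fun_prop), fun κ hκ x => ?_⟩
  unfold wt
  by_cases h1 : x ∈ tsupport f
  · by_cases h2 : x + (2 * π) • κ ∈ tsupport g
    · refine absurd ⟨(x, x + (2 * π) • κ), ⟨h1, h2⟩, ?_⟩ hκ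
      simp only [add_sub_cancel_left]
      rw [inv_smul_smul₀ (by positivity)]
    · rw [image_eq_zero_of_notMem_tsupport h2]; simp
  · rw [image_eq_zero_of_notMem_tsupport h1]; simp

lemma TT_zero {d : ℕ} (U : Matrix (Fin d) (Fin d) ℝ) {ι : Type} [Fintype ι] (φ φt : ι → CF d) (f g : CF d)
    (κ : Fin d → ℝ) (h : (∀ m : Fin d → ℤ, U.mulVec κ ≠ iv m) ∨ ∀ x, wt f g κ x = 0) :
    TT U φ φt f g κ = 0 := by
  unfold TT
  rcases h with h | h
  · simp [Ipair_not φ φt _ _ h]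
  · simp [h]

lemma TT_fin {d : ℕ} (U : Matrix (Fin d) (Fin d) ℝ) (hU : U.det ≠ 0) {ι : Type} [Fintype ι] 
    (φ φt : ι → CF d) (f g : CF d) (hf : IsTest f) (hg : IsTest g) :
    (Function.support (TT U φ φt f g)).Finite := by
  obtain ⟨K, hK, hK0⟩ := exists_shift hf hg
  have hu : IsUnit U.det := isUnit_iff_ne_zero.mpr hU
  have h1 := iv_finite ((fun x => U.mulVec x) '' K) (hK.image (mulVec_emb hU).continuous)
  refine (h1.image (fun k => U⁻¹.mulVec (iv k))).subset ?_
  intro κ hκ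
  by_cases h : ∀ m : Fin d → ℤ, U.mulVec κ ≠ iv m
  · exact absurd (TT_zero U φ φt f g κ (Or.inl h)) hκ
  push Not at h
  obtain ⟨m, hm⟩ := h
  refine ⟨m, ⟨κ, ?_, hm⟩, ?_⟩
  · by_contra hk
    exact hκ (TT_zero U φ φt f g κ (Or.inr (hK0 κ hk)))
  · simp only [← hm, Matrix.mulVec_mulVec, Matrix.nonsing_inv_mul U hu, Matrix.one_mulVec]

lemma TT_iv {d : ℕ} (U : Matrix (Fin d) (Fin d) ℝ) (hU : U.det ≠ 0) {ι : Type} [Fintype ι] 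
    {φ φt : ι → CF d} (hφ : ∀ ℓ, LocL2 (φ ℓ)) (hφt : ∀ ℓ, LocL2 (φt ℓ)) 
    (f g : CF d) (hf : IsTest f) (hg : IsTest g) (k : Fin d → ℤ) :
    TT U φ φt f g (U⁻¹.mulVec (iv k)) = ∑ ℓ, brk U (φ ℓ) (φt ℓ) f g k := by
  have hu : IsUnit U.det := isUnit_iff_ne_zero.mpr hU
  unfold TT brk
  rw [← integral_finsetSum]
  · refine integral_congr_ae (Eventually.of_forall fun x => ?_)
    simp only [Matrix.mulVec_mulVec, Matrix.mul_nonsing_inv U hu, Matrix.one_mulVec, Ipair_int,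
      Finset.mul_sum, wt]
  · intro ℓ _
    have h1 := ((hφ ℓ).comp_affine hU 0).conj
    simp only [add_zero] at h1
    exact wt_int hf hg _ (h1.mul_li ((hφt ℓ).comp_affine hU _))

lemma hasSum_fin_prod {ι β : Type} [Fintype ι] (u : ι × β → ℂ) (a : ι → ℂ)
    (h : ∀ i, HasSum (fun b => u (i, b)) (a i)) : HasSum u (∑ i, a i) := by
  classical
  have h1 : ∀ i, HasSum (fun p : ι × β => if p.1 = i then u p else 0) (a i) := by
    intro i
    have hinj : Function.Injective (fun b : β => (i, b)) := Prod.mk_right_injective i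
    rw [← hinj.hasSum_iff]
    · refine (h i).congr_fun fun b => ?_
      simp
    · rintro ⟨j, b⟩ hp
      refine if_neg fun hj => hp ⟨b, ?_⟩
      simp only at hj
      rw [hj]
  refine (hasSum_sum fun i (_ : i ∈ Finset.univ) => h1 i).congr_fun fun p => ?_
  simp

/-- raw term -/
def PP {d : ℕ} (U : Matrix (Fin d) (Fin d) ℝ) {ι : Type} (φ φt : ι → CF d) (f g : CF d)
    (p : ι × (Fin d → ℤ)) : ℂ := ip f (fdil U p.2 (φ p.1)) * ip (fdil U p.2 (φt p.1)) g

lemma key3 {d : ℕ} (U : Matrix (Fin d) (Fin d) ℝ) (hU : U.det ≠ 0) {ι : Type} [Fintype ι] 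
    {φ φt : ι → CF d} (hφ : ∀ ℓ, LocL2 (φ ℓ)) (hφt : ∀ ℓ, LocL2 (φt ℓ)) 
    (f g : CF d) (hf : IsTest f) (hg : IsTest g) :
    HasSum (PP U φ φt f g) ((((2 * π) ^ d : ℝ) : ℂ) * ∑' κ, TT U φ φt f g κ) := by
  have h1 := hasSum_fin_prod (PP U φ φt f g) _ 
    (fun ℓ => key1 U hU (φ ℓ) (φt ℓ) f g (hφ ℓ) (hφt ℓ) hf hg)
  have hu : IsUnit U.det := isUnit_iff_ne_zero.mpr hU
  have hbs : ∀ ℓ, Summable (brk U (φ ℓ) (φt ℓ) f g) := by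
    intro ℓ
    obtain ⟨K, hK, hK0⟩ := exists_shift hf hg
    have h1 := iv_finite ((fun x => U.mulVec x) '' K) (hK.image (mulVec_emb hU).continuous)
    refine summable_of_hasFiniteSupport (h1.subset fun k hk => ?_)
    refine ⟨U⁻¹.mulVec (iv k), ?_, ?_⟩
    · by_contra hc
      refine hk ?_
      have := hK0 _ hc
      unfold wt at this
      simp [brk, this]
    · simp only [Matrix.mulVec_mulVec, Matrix.mul_nonsing_inv U hu, Matrix.one_mulVec]
  have hinj : Function.Injective (fun k : Fin d → ℤ => U⁻¹.mulVec (iv k)) := by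
    intro k l hkl
    have := congrArg (fun v => U.mulVec v) hkl
    simp only [Matrix.mulVec_mulVec, Matrix.mul_nonsing_inv U hu, Matrix.one_mulVec] at this
    ext i
    have := congrFun this i
    simpa [iv] using this
  have h2 : ∑' κ, TT U φ φt f g κ = ∑' k, TT U φ φt f g (U⁻¹.mulVec (iv k)) := by
    refine (hinj.tsum_eq ?_).symm
    intro κ hκ
    by_cases h : ∀ m : Fin d → ℤ, U.mulVec κ ≠ iv m
    · exact absurd (TT_zero U φ φt f g κ (Or.inl h)) hκ
    push Not at h
    obtain ⟨m, hm⟩ := h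
    refine ⟨m, ?_⟩
    simp only [← hm, Matrix.mulVec_mulVec, Matrix.nonsing_inv_mul U hu, Matrix.one_mulVec]
  rw [h2]
  simp only [TT_iv U hU hφ hφt f g hf hg]
  rw [Summable.tsum_finsetSum (fun ℓ _ => hbs ℓ), Finset.mul_sum]
  exact h1

lemma PP_scale {d : ℕ} (V W : Matrix (Fin d) (Fin d) ℝ) (hW : W.det ≠ 0) {ι : Type} 
    (φ φt : ι → CF d) (f g : CF d) (p : ι × (Fin d → ℤ)) :
    PP (V * W) φ φt (fun x => f (W.mulVec x)) (fun x => g (W.mulVec x)) p =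
      ((|W.det|⁻¹ : ℝ) : ℂ) * PP V φ φt f g p := by
  have h1 : ∀ (f φ : CF d) (k : Fin d → ℤ), ip (fun x => f (W.mulVec x)) (fdil (V * W) k φ) =
     ((Real.sqrt |W.det| * |W.det|⁻¹ : ℝ) : ℂ) * ip f (fdil V k φ) := by
    intro f φ k
    unfold ip
    have := integral_comp_mulVec hW (fun x => f x * (starRingEnd ℂ) (fdil V k φ x))
    rw [Complex.ofReal_mul, mul_assoc, ← this, ← integral_const_mul]
    congr 1; ext x
    simp only [fdil, Matrix.det_mul, abs_mul, Real.sqrt_mul (abs_nonneg _), Matrix.mulVec_mulVec]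
    simp only [map_mul, Complex.conj_ofReal]
    push_cast
    ring
  unfold PP
  rw [ip_conj _ g, ip_conj _ (fun x => g (W.mulVec x)), h1, h1]
  simp only [map_mul, Complex.conj_ofReal]
  have h3 : (|W.det|⁻¹ : ℝ) = (Real.sqrt |W.det| * |W.det|⁻¹) * (Real.sqrt |W.det| * |W.det|⁻¹) := by
    rw [mul_mul_mul_comm, Real.mul_self_sqrt (abs_nonneg _), mul_inv_cancel_left₀ (abs_ne_zero.mpr hW)]
  have h4 : ((|W.det|⁻¹ : ℝ) : ℂ) = ((Real.sqrt |W.det| * |W.det|⁻¹ : ℝ) : ℂ) *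
      ((Real.sqrt |W.det| * |W.det|⁻¹ : ℝ) : ℂ) := by
    rw [← Complex.ofReal_mul, ← h3]
  rw [h4]
  ring

lemma ip_scale {d : ℕ} (W : Matrix (Fin d) (Fin d) ℝ) (hW : W.det ≠ 0) (f g : CF d) :
    ip (fun x => f (W.mulVec x)) (fun x => g (W.mulVec x)) = ((|W.det|⁻¹ : ℝ) : ℂ) * ip f g :=
  integral_comp_mulVec hW (fun x => f x * (starRingEnd ℂ) (g x))

section Pow
attribute [local instance] Matrix.linftyOpNormedRing Matrix.linftyOpNormedAlgebra

lemma pow_tendsto_aux {n : ℕ} (A : Matrix (Fin n) (Fin n) ℂ) (hA : ∀ μ ∈ spectrum ℂ A, ‖μ‖ < 1) :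
    Tendsto (fun m : ℕ => ‖A ^ m‖) atTop (𝓝 0) := by
  rcases Nat.eq_zero_or_pos n with h0 | h0
  · subst h0
    have : ∀ m, A ^ m = 0 := fun m => Subsingleton.elim _ _
    simp [this]
  have : Nonempty (Fin n) := ⟨⟨0, h0⟩⟩
  have hs : spectralRadius ℂ A < ((1 : NNReal) : ENNReal) :=
    spectrum.spectralRadius_lt_of_forall_lt A (fun μ hμ => by exact_mod_cast hA μ hμ)
  obtain ⟨r, hr1, hr2⟩ := exists_between hs
  lift r to NNReal using (hr2.trans_le le_top).ne
  have h1 := (spectrum.pow_nnnorm_pow_one_div_tendsto_nhds_spectralRadius A).eventually_lt_const hr1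
  have hr : (r : ℝ) < 1 := by exact_mod_cast hr2
  refine squeeze_zero' (Eventually.of_forall fun m => norm_nonneg _) ?_ 
    (tendsto_pow_atTop_nhds_zero_of_lt_one r.coe_nonneg hr)
  filter_upwards [h1, eventually_gt_atTop 0] with m hm hm0
  have hm0' : (0 : ℝ) < m := by exact_mod_cast hm0
  have h2 := ENNReal.rpow_le_rpow hm.le hm0'.le
  rw [← ENNReal.rpow_mul, one_div, inv_mul_cancel₀ hm0'.ne', ENNReal.rpow_one, ENNReal.rpow_natCast] at h2
  exact_mod_cast h2

lemma expansive_det {d : ℕ} {M : Matrix (Fin d) (Fin d) ℝ} (hM : Expansive M) : M.det ≠ 0 := by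
  intro h
  have h1 : (M.map (Complex.ofReal : ℝ → ℂ)).det = 0 := by
    have := (RingHom.map_det Complex.ofRealHom M).symm
    rw [h, map_zero] at this
    exact this
  have h2 : (0 : ℂ) ∈ spectrum ℂ (M.map (Complex.ofReal : ℝ → ℂ)) := by
    rw [spectrum.zero_mem_iff, Matrix.isUnit_iff_isUnit_det, h1]
    simp
  have := hM 0 h2
  norm_num at this

lemma expansive_pow {d : ℕ} {M N : Matrix (Fin d) (Fin d) ℝ} (hM : Expansive M) 
    (hN : N = (M.transpose)⁻¹) (R : ℝ) :
    ∀ᶠ j : ℤ in atTop, ∀ κ : Fin d → ℝ, ‖κ‖ ≤ R → ‖(N ^ j).mulVec κ‖ < 1 := by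
  have hd := expansive_det hM
  have hu : IsUnit M.transpose.det := by rw [Matrix.det_transpose]; exact isUnit_iff_ne_zero.mpr hd
  set A : Matrix (Fin d) (Fin d) ℂ := N.map (Complex.ofReal : ℝ → ℂ) with hA
  set B : Matrix (Fin d) (Fin d) ℂ := M.transpose.map (Complex.ofReal : ℝ → ℂ) with hB
  have hAB : A * B = 1 := by
    have := congrArg (fun X : Matrix (Fin d) (Fin d) ℝ => X.map Complex.ofRealHom) 
      (Matrix.nonsing_inv_mul M.transpose hu)
    simp only [Matrix.map_mul] at this
    rw [hA, hB, hN]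
    refine this.trans ?_
    exact Matrix.map_one _ (map_zero _) (map_one _)
  have hBA : B * A = 1 := mul_eq_one_comm.mp hAB
  have hspec : ∀ μ ∈ spectrum ℂ A, ‖μ‖ < 1 := by
    intro μ hμ
    let u : (Matrix (Fin d) (Fin d) ℂ)ˣ := ⟨A, B, hAB, hBA⟩
    have hμ0 : μ ≠ 0 := by
      rintro rfl
      rw [spectrum.zero_mem_iff] at hμ
      exact hμ u.isUnit
    have h1 : (Units.mk0 μ hμ0 : ℂ) ∈ spectrum ℂ (u : Matrix (Fin d) (Fin d) ℂ) := hμ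
    rw [spectrum.inv_mem_iff] at h1
    have h2 : μ⁻¹ ∈ spectrum ℂ B := h1
    have h3 : μ⁻¹ ∈ spectrum ℂ (M.map (Complex.ofReal : ℝ → ℂ)) := by
      rw [Matrix.mem_spectrum_iff_isRoot_charpoly] at h2 ⊢
      rw [hB, Matrix.transpose_map, Matrix.charpoly_transpose] at h2
      exact h2
    have h4 := hM _ h3
    rw [norm_inv] at h4
    exact (one_lt_inv₀ (norm_pos_iff.mpr hμ0)).mp h4
  have ht := pow_tendsto_aux A hspec
  have ht2 : Tendsto (fun m : ℕ => ‖A ^ m‖ * |R|) atTop (𝓝 0) := by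
    simpa using ht.mul_const |R|
  have ht3 := ht2.eventually_lt_const zero_lt_one
  obtain ⟨m0, hm0⟩ := eventually_atTop.mp ht3
  filter_upwards [eventually_ge_atTop (m0 : ℤ)] with j hj κ hκ
  obtain ⟨m, rfl⟩ : ∃ m : ℕ, j = m := ⟨j.toNat, by omega⟩
  have hm := hm0 m (by exact_mod_cast hj)
  rw [zpow_natCast]
  have h5 : A ^ m = (N ^ m).map Complex.ofRealHom := (Matrix.map_pow N Complex.ofRealHom m).symm
  have h6 : (A ^ m).mulVec (fun i => (κ i : ℂ)) = fun i => (((N ^ m).mulVec κ i : ℝ) : ℂ) := by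
    rw [h5]
    ext i
    simp [Matrix.mulVec, dotProduct]
  have h7 : ∀ v : Fin d → ℝ, ‖(fun i => (v i : ℂ))‖ = ‖v‖ := by
    intro v
    simp [Pi.norm_def]
  rw [← h7, ← h6]
  refine (Matrix.linfty_opNorm_mulVec _ _).trans_lt ?_
  rw [h7]
  refine lt_of_le_of_lt ?_ hm
  exact mul_le_mul_of_nonneg_left (hκ.trans (le_abs_self R)) (norm_nonneg _)
end Pow

lemma wlim_eq {d : ℕ} {M N : Matrix (Fin d) (Fin d) ℝ} (hM : Expansive M) 
    (hN : N = (M.transpose)⁻¹) (hNd : N.det ≠ 0) {ι : Type} [Fintype ι]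
    {φ φt : ι → CF d} (hφ : ∀ ℓ, LocL2 (φ ℓ)) (hφt : ∀ ℓ, LocL2 (φt ℓ)) 
    (f g : CF d) (hf : IsTest f) (hg : IsTest g) :
    ∀ᶠ j : ℤ in atTop, ∑' p, PP (N ^ j) φ φt f g p = (((2 * π) ^ d : ℝ) : ℂ) * 
      ∫ ξ, (∑ ℓ, (starRingEnd ℂ) (φ ℓ ((N ^ j).mulVec ξ)) * φt ℓ ((N ^ j).mulVec ξ)) *
        (f ξ * (starRingEnd ℂ) (g ξ)) := by
  obtain ⟨K, hK, hK0⟩ := exists_shift hf hg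
  obtain ⟨R, hR⟩ := hK.isBounded.exists_norm_le
  filter_upwards [expansive_pow hM hN R] with j hj
  have hjd : (N ^ j).det ≠ 0 := ((isUnit_iff_ne_zero.mpr hNd).det_zpow j).ne_zero
  rw [(key3 (N ^ j) hjd hφ hφt f g hf hg).tsum_eq, tsum_eq_single 0]
  · congr 1
    unfold TT
    refine integral_congr_ae (Eventually.of_forall fun x => ?_)
    have h0 : (0 : Fin d → ℝ) = iv 0 := by ext i; simp [iv]
    simp only [Matrix.mulVec_zero, wt, smul_zero, add_zero]
    rw [h0, Ipair_int, ← h0, smul_zero, add_zero, mul_comm]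
  · intro κ hκ
    refine TT_zero _ _ _ _ _ _ ?_
    by_cases hk : κ ∈ K
    · left
      intro m hm
      have h1 := hj κ (hR κ hk)
      rw [hm] at h1
      have hm0 : m = 0 := by
        ext i
        have h2 := (norm_le_pi_norm (iv m) i).trans_lt h1
        have h3 : |(m i : ℝ)| < 1 := h2
        have h4 : |m i| < 1 := by exact_mod_cast h3
        simpa [Int.abs_lt_one_iff] using h4
      refine hκ ((mulVec_emb hjd).injective ?_)
      simp only [Matrix.mulVec_zero]
      rw [hm, hm0]
      ext i; simp [iv]
    · right
      exact hK0 κ hk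

lemma part1 {d : ℕ} {M N : Matrix (Fin d) (Fin d) ℝ} (hM : Expansive M) 
    (hN : N = (M.transpose)⁻¹) (hNd : N.det ≠ 0) {ι : Type} [Fintype ι]
    {φ φt : ι → CF d} (hφ : ∀ ℓ, LocL2 (φ ℓ)) (hφt : ∀ ℓ, LocL2 (φt ℓ)) :
    (∀ f g : CF d, IsTest f → IsTest g → 
      Tendsto (fun j : ℤ => ∑' p, PP (N ^ j) φ φt f g p) atTop 
        (𝓝 ((((2 * π) ^ d : ℝ) : ℂ) * ip f g))) ↔
    (∀ h : CF d, IsTest h →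
        Tendsto (fun j : ℤ =>
            ∫ ξ, (∑ ℓ, (starRingEnd ℂ) (φ ℓ ((N ^ j).mulVec ξ)) *
                φt ℓ ((N ^ j).mulVec ξ)) * (starRingEnd ℂ) (h ξ))
          atTop (𝓝 (∫ ξ, (starRingEnd ℂ) (h ξ)))) := by
  have hc : (((2 * π) ^ d : ℝ) : ℂ) ≠ 0 := by
    rw [Complex.ofReal_ne_zero]; positivity
  constructor
  · intro H h hh
    obtain ⟨χ, hχ1, hχ2, hχ3⟩ : ∃ χ : (Fin d → ℝ) → ℝ, ContDiff ℝ (⊤ : ℕ∞) χ ∧ HasCompactSupport χ ∧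
        ∀ x ∈ tsupport h, χ x = 1 := by
      obtain ⟨R, hR⟩ := hh.2.isCompact.isBounded.exists_norm_le
      let b : ContDiffBump (0 : Fin d → ℝ) := ⟨|R| + 1, |R| + 2, by positivity, by linarith⟩
      refine ⟨b, b.contDiff, b.hasCompactSupport, fun x hx => b.one_of_mem_closedBall ?_⟩
      rw [mem_closedBall_zero_iff]
      have := hR x hx
      have := le_abs_self R
      change ‖x‖ ≤ |R| + 1
      linarith
    have hf : IsTest (fun x => (χ x : ℂ)) := 
      ⟨Complex.ofRealCLM.contDiff.comp hχ1, hχ2.comp_left (g := Complex.ofReal) (by simp)⟩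
    have hfh : ∀ x, (χ x : ℂ) * (starRingEnd ℂ) (h x) = (starRingEnd ℂ) (h x) := by
      intro x
      by_cases hx : x ∈ tsupport h
      · rw [hχ3 x hx]; simp
      · rw [image_eq_zero_of_notMem_tsupport hx]; simp
    have h1 := H _ h hf hh
    have h2 := (h1.congr' (wlim_eq hM hN hNd hφ hφt _ h hf hh)).const_mul (((2 * π) ^ d : ℝ) : ℂ)⁻¹
    simp only [inv_mul_cancel_left₀ hc, hfh, ip] at h2
    exact h2
  · intro H f g hf hg
    refine Tendsto.congr' (EventuallyEq.symm (wlim_eq hM hN hNd hφ hφt f g hf hg)) ?_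
    refine Tendsto.const_mul _ ?_
    have hh : IsTest (fun x => (starRingEnd ℂ) (f x) * g x) := 
      ⟨(Complex.conjCLE.contDiff.comp hf.1).mul hg.1, hg.2.mul_left⟩
    have := H _ hh
    simpa only [map_mul, Complex.conj_conj, ip] using this

lemma part2_rev {d : ℕ} {M N : Matrix (Fin d) (Fin d) ℝ} (hMd : M.det ≠ 0)
    (hN : N = (M.transpose)⁻¹) (hNd : N.det ≠ 0) {ι ι' : Type} [Fintype ι] [Fintype ι']
    {φ φt : ι → CF d} (hφ : ∀ ℓ, LocL2 (φ ℓ)) (hφt : ∀ ℓ, LocL2 (φt ℓ))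
    {ψ ψt : ι' → CF d} (hψ : ∀ ℓ, LocL2 (ψ ℓ)) (hψt : ∀ ℓ, LocL2 (ψt ℓ)) 
    (E : CF d → CF d → (Fin d → ℝ) → ℂ)
    (hE : E = fun f g κ => TT 1 φ φt f g κ + TT 1 ψ ψt f g κ - TT N φ φt f g κ) 
    (D : (Fin d → ℝ) → CF d)
    (hD : D = fun κ ξ => Ipair φ φt κ ξ + Ipair ψ ψt κ ξ - Ipair φ φt (N.mulVec κ) (N.mulVec ξ))
    (Λ : Set (Fin d → ℝ)) (hΛ : Λ = {k | ((∀ i, ∃ m : ℤ, k i = (m : ℝ)) ∨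
         (∃ m : Fin d → ℤ, k = M.transpose.mulVec (iv m)))}) :
    (∀ κ, LocallyIntegrable (D κ) volume) ∧
    (∀ f g, IsTest f → IsTest g → ∀ κ, E f g κ = ∫ x, wt f g κ x * D κ x) ∧ 
    (∀ f g, IsTest f → IsTest g → ∀ κ ∉ Λ, E f g κ = 0) ∧
    (∀ f g, IsTest f → IsTest g → ((∑' p, PP 1 φ φt f g p) + (∑' p, PP 1 ψ ψt f g p) = 
      ∑' p, PP N φ φt f g p ↔ ∑' κ, E f g κ = 0)) := by
  have h1d : (1 : Matrix (Fin d) (Fin d) ℝ).det ≠ 0 := by simp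
  have hu : IsUnit M.transpose.det := by rw [Matrix.det_transpose]; exact isUnit_iff_ne_zero.mpr hMd
  have hc : (((2 * π) ^ d : ℝ) : ℂ) ≠ 0 := by
    rw [Complex.ofReal_ne_zero]; positivity
  have l1 : ∀ κ, LocallyIntegrable (fun ξ => Ipair φ φt κ ξ) volume := fun κ => by
    simpa only [Matrix.one_mulVec] using Ipair_li hφ hφt h1d κ
  have l2 : ∀ κ, LocallyIntegrable (fun ξ => Ipair ψ ψt κ ξ) volume := fun κ => by
    simpa only [Matrix.one_mulVec] using Ipair_li hψ hψt h1d κ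
  have l3 : ∀ κ, LocallyIntegrable (fun ξ => Ipair φ φt (N.mulVec κ) (N.mulVec ξ)) volume := fun κ => 
    Ipair_li hφ hφt hNd _
  refine ⟨fun κ => ?_, fun f g hf hg κ => ?_, fun f g hf hg κ hκ => ?_, fun f g hf hg => ?_⟩
  · rw [hD]; exact ((l1 κ).add (l2 κ)).sub (l3 κ)
  · rw [hE, hD]
    simp only [TT, Matrix.one_mulVec]
    have hadd : Integrable (fun x => wt f g κ x * Ipair φ φt κ x + wt f g κ x * Ipair ψ ψt κ x) :=
      (wt_int hf hg κ (l1 κ)).add (wt_int hf hg κ (l2 κ))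
    rw [← integral_add (wt_int hf hg κ (l1 κ)) (wt_int hf hg κ (l2 κ)), ← integral_sub
      hadd (wt_int hf hg κ (l3 κ))]
    congr 1; ext x; ring
  · rw [hΛ] at hκ
    simp only [Set.mem_setOf_eq, not_or] at hκ
    have h1 : ∀ m : Fin d → ℤ, (1 : Matrix (Fin d) (Fin d) ℝ).mulVec κ ≠ iv m := by
      intro m hm
      rw [Matrix.one_mulVec] at hm
      exact hκ.1 fun i => ⟨m i, congrFun hm i⟩
    have h2 : ∀ m : Fin d → ℤ, N.mulVec κ ≠ iv m := by
      intro m hm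
      refine hκ.2 ⟨m, ?_⟩
      rw [← hm, hN, Matrix.mulVec_mulVec, Matrix.mul_nonsing_inv _ hu, Matrix.one_mulVec]
    rw [hE]
    simp only [TT_zero 1 φ φt f g κ (Or.inl h1), TT_zero 1 ψ ψt f g κ (Or.inl h1), 
      TT_zero N φ φt f g κ (Or.inl h2), add_zero, sub_zero]
  · rw [(key3 1 h1d hφ hφt f g hf hg).tsum_eq, (key3 1 h1d hψ hψt f g hf hg).tsum_eq,
      (key3 N hNd hφ hφt f g hf hg).tsum_eq, ← mul_add, mul_right_inj' hc, hE]
    have s1 : Summable (TT 1 φ φt f g) := summable_of_hasFiniteSupport (TT_fin 1 h1d φ φt f g hf hg)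
    have s2 : Summable (TT 1 ψ ψt f g) := summable_of_hasFiniteSupport (TT_fin 1 h1d ψ ψt f g hf hg)
    have s3 : Summable (TT N φ φt f g) := summable_of_hasFiniteSupport (TT_fin N hNd φ φt f g hf hg)
    simp only []
    rw [(s1.add s2).tsum_sub s3, s1.tsum_add s2, sub_eq_zero]

lemma part2_loc {d : ℕ} (Λ : Set (Fin d → ℝ)) (M : Matrix (Fin d) (Fin d) ℝ) (hMd : M.det ≠ 0)
    (hΛ : Λ = {k | ((∀ i, ∃ m : ℤ, k i = (m : ℝ)) ∨
         (∃ m : Fin d → ℤ, k = M.transpose.mulVec (iv m)))}) (κ0 : Fin d → ℝ) :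
    ∃ ε > 0, ∀ κ, ‖κ - κ0‖ < ε → κ ≠ κ0 → κ ∉ Λ := by
  have hT : M.transpose.det ≠ 0 := by rwa [Matrix.det_transpose]
  have hu : IsUnit M.transpose.det := isUnit_iff_ne_zero.mpr hT
  have hK := isCompact_closedBall κ0 1
  have hK2 : IsCompact ((fun x => (M.transpose)⁻¹.mulVec x) '' Metric.closedBall κ0 1) := 
    hK.image (by fun_prop)
  have hfin : (Λ ∩ Metric.closedBall κ0 1).Finite := by
    refine (((iv_finite _ hK).image iv).union 
      ((iv_finite _ hK2).image fun m => M.transpose.mulVec (iv m))).subset ?_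
    rintro κ ⟨h1, h2⟩
    rw [hΛ] at h1
    rcases h1 with h1 | ⟨m, rfl⟩
    · left
      choose m hm using h1
      have : iv m = κ := (funext hm).symm
      exact ⟨m, by rw [Set.mem_setOf_eq, this]; exact h2, this⟩
    · right
      refine ⟨m, ⟨_, h2, ?_⟩, rfl⟩
      simp only [Matrix.mulVec_mulVec, Matrix.nonsing_inv_mul _ hu, Matrix.one_mulVec]
  have hcl : IsClosed ((Λ ∩ Metric.closedBall κ0 1) \ {κ0}) := (hfin.subset Set.diff_subset).isClosed
  have hn : ((Λ ∩ Metric.closedBall κ0 1) \ {κ0})ᶜ ∈ 𝓝 κ0 := hcl.isOpen_compl.mem_nhds (by simp)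
  obtain ⟨ε, hε, hb⟩ := Metric.mem_nhds_iff.mp hn
  refine ⟨min ε 1, by positivity, fun κ h1 h2 h3 => ?_⟩
  have h4 : κ ∈ Metric.ball κ0 ε := by
    rw [mem_ball_iff_norm]; exact h1.trans_le (min_le_left _ _)
  refine hb h4 ⟨⟨h3, ?_⟩, h2⟩
  rw [mem_closedBall_iff_norm]; exact (h1.trans_le (min_le_right _ _)).le

lemma part2 {d : ℕ} {M N : Matrix (Fin d) (Fin d) ℝ} (hMd : M.det ≠ 0)
    (hN : N = (M.transpose)⁻¹) (hNd : N.det ≠ 0) {ι ι' : Type} [Fintype ι] [Fintype ι']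
    {φ φt : ι → CF d} (hφ : ∀ ℓ, LocL2 (φ ℓ)) (hφt : ∀ ℓ, LocL2 (φt ℓ))
    {ψ ψt : ι' → CF d} (hψ : ∀ ℓ, LocL2 (ψ ℓ)) (hψt : ∀ ℓ, LocL2 (ψt ℓ)) :
    (∀ f g, IsTest f → IsTest g → (∑' p, PP 1 φ φt f g p) + (∑' p, PP 1 ψ ψt f g p) = 
      ∑' p, PP N φ φt f g p) ↔ 
    (∀ k : Fin d → ℝ,
        ((∀ i, ∃ m : ℤ, k i = (m : ℝ)) ∨
         (∃ m : Fin d → ℤ, k = M.transpose.mulVec (iv m))) →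
        ∀ᵐ ξ : Fin d → ℝ,
          Ipair φ φt k ξ + Ipair ψ ψt k ξ
            = Ipair φ φt (N.mulVec k) (N.mulVec ξ)) := by
  obtain ⟨E, hE⟩ : ∃ E : CF d → CF d → (Fin d → ℝ) → ℂ, 
    E = fun f g κ => TT 1 φ φt f g κ + TT 1 ψ ψt f g κ - TT N φ φt f g κ := ⟨_, rfl⟩
  obtain ⟨D, hD⟩ : ∃ D : (Fin d → ℝ) → CF d, D = fun κ ξ => 
    Ipair φ φt κ ξ + Ipair ψ ψt κ ξ - Ipair φ φt (N.mulVec κ) (N.mulVec ξ) := ⟨_, rfl⟩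
  obtain ⟨Λ, hΛ⟩ : ∃ Λ : Set (Fin d → ℝ), Λ = {k | ((∀ i, ∃ m : ℤ, k i = (m : ℝ)) ∨
         (∃ m : Fin d → ℤ, k = M.transpose.mulVec (iv m)))} := ⟨_, rfl⟩
  obtain ⟨p1, p2, p3, p4⟩ := part2_rev hMd hN hNd hφ hφt hψ hψt E hE D hD Λ hΛ
  constructor
  · intro H k _
    suffices hs : ∀ᵐ ξ, D k ξ = 0 by
      filter_upwards [hs] with ξ hξ
      rw [hD] at hξ
      exact sub_eq_zero.mp hξ
    obtain ⟨ε, hε, hsep⟩ := part2_loc Λ M hMd hΛ k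
    have hloc : ∀ x0 : Fin d → ℝ, ∀ᵐ x, x ∈ Metric.ball x0 ε → D k x = 0 := by
      intro x0
      refine Metric.isOpen_ball.ae_eq_zero_of_integral_contDiff_smul_eq_zero
        ((p1 k).locallyIntegrableOn _) ?_
      intro u hu1 hu2 hu3
      let b : ContDiffBump (x0 + (2 * π) • k) := ⟨ε, 2 * ε, hε, by linarith⟩
      have hf : IsTest (fun x => (u x : ℂ)) := 
        ⟨Complex.ofRealCLM.contDiff.comp hu1, hu2.comp_left (g := Complex.ofReal) (by simp)⟩
      have hg : IsTest (fun x => (b x : ℂ)) := 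
        ⟨Complex.ofRealCLM.contDiff.comp b.contDiff, 
          b.hasCompactSupport.comp_left (g := Complex.ofReal) (by simp)⟩
      have h1 := (p4 _ _ hf hg).mp (H _ _ hf hg)
      rw [tsum_eq_single k] at h1
      · rw [p2 _ _ hf hg] at h1
        rw [← h1]
        refine integral_congr_ae (Eventually.of_forall fun x => ?_)
        simp only [wt]
        by_cases hx : x ∈ tsupport u
        · have hx2 := hu3 hx
          have : b (x + (2 * π) • k) = 1 := by
            refine b.one_of_mem_closedBall ?_
            rw [mem_closedBall_iff_norm, add_sub_add_right_eq_sub]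
            exact (mem_ball_iff_norm.mp hx2).le
          rw [this]; simp
        · rw [image_eq_zero_of_notMem_tsupport hx]; simp
      · intro κ hκ
        by_cases hκ2 : ‖κ - k‖ < ε
        · exact p3 _ _ hf hg κ (hsep κ hκ2 hκ)
        · rw [p2 _ _ hf hg]
          rw [integral_eq_zero_of_ae]
          refine Eventually.of_forall fun x => ?_
          simp only [wt, Pi.zero_apply]
          by_cases hx : x ∈ tsupport u
          · have hx2 := mem_ball_iff_norm.mp (hu3 hx)
            have : b (x + (2 * π) • κ) = 0 := by
              refine b.zero_of_le_dist ?_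
              change 2 * ε ≤ _
              rw [dist_eq_norm]
              have e1 : (2 * π) • (κ - k) = (x + (2 * π) • κ - (x0 + (2 * π) • k)) - (x - x0) := by
                rw [smul_sub]; abel
              have e2 := norm_sub_le (x + (2 * π) • κ - (x0 + (2 * π) • k)) (x - x0)
              rw [← e1, norm_smul, Real.norm_of_nonneg (by positivity)] at e2
              have := Real.pi_gt_three
              push Not at hκ2
              nlinarith
            rw [this]; simp
          · rw [image_eq_zero_of_notMem_tsupport hx]; simp
    rw [ae_iff]
    refine measure_null_of_locally_null _ fun x _ => ⟨{a | ¬ D k a = 0} ∩ Metric.ball x ε, 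
      inter_mem self_mem_nhdsWithin (mem_nhdsWithin_of_mem_nhds (Metric.ball_mem_nhds x hε)), ?_⟩
    have := ae_iff.mp (hloc x)
    refine measure_mono_null ?_ this
    rintro a ⟨h1, h2⟩ h3
    exact h1 (h3 h2)
  · intro H f g hf hg
    rw [p4 f g hf hg]
    have : ∀ κ, E f g κ = 0 := by
      intro κ
      by_cases hκ : κ ∈ Λ
      · rw [p2 f g hf hg]
        refine integral_eq_zero_of_ae ?_
        rw [hΛ] at hκ
        filter_upwards [H κ hκ] with x hx
        rw [hD]
        simp [hx]
      · exact p3 f g hf hg κ hκ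
    simp [this]

lemma SS_scale {d : ℕ} {N : Matrix (Fin d) (Fin d) ℝ} (hNd : N.det ≠ 0) {ι : Type} [Fintype ι]
    (φ φt : ι → CF d) (f g : CF d) (i j : ℤ) :
    ∑' p, PP (N ^ (j + i)) φ φt (fun x => f ((N ^ i).mulVec x)) (fun x => g ((N ^ i).mulVec x)) p
      = ((|(N ^ i).det|⁻¹ : ℝ) : ℂ) * ∑' p, PP (N ^ j) φ φt f g p := by
  have hu := isUnit_iff_ne_zero.mpr hNd
  have hi : (N ^ i).det ≠ 0 := (hu.det_zpow i).ne_zero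
  rw [Matrix.zpow_add hu, ← tsum_mul_left]
  exact tsum_congr fun p => PP_scale (N ^ j) (N ^ i) hi φ φt f g p

lemma test_shift {d : ℕ} {N : Matrix (Fin d) (Fin d) ℝ} (hNd : N.det ≠ 0) {f : CF d}
    (hf : IsTest f) (i : ℤ) : ∃ f', IsTest f' ∧ f = fun x => f' ((N ^ i).mulVec x) := by
  have hu := isUnit_iff_ne_zero.mpr hNd
  refine ⟨fun x => f ((N ^ (-i)).mulVec x), hf.comp_mulVec (hu.det_zpow (-i)).ne_zero, ?_⟩
  ext x
  simp only [Matrix.mulVec_mulVec]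
  rw [← Matrix.zpow_add hu, neg_add_cancel, zpow_zero, Matrix.one_mulVec]

section fin
variable {d : ℕ} {N : Matrix (Fin d) (Fin d) ℝ} {ι ι' : Type} [Fintype ι] [Fintype ι']
    {φ φt : ι → CF d} {ψ ψt : ι' → CF d}

lemma dd_iff (hNd : N.det ≠ 0)
    (hφ : ∀ ℓ, LocL2 (φ ℓ)) (hφt : ∀ ℓ, LocL2 (φt ℓ))
    (hψ : ∀ ℓ, LocL2 (ψ ℓ)) (hψt : ∀ ℓ, LocL2 (ψt ℓ)) (J : ℤ) :
    DualDistr (fun j : ℤ => N ^ j) J φ φt (fun _ : ℤ => ψ) (fun _ : ℤ => ψt) ↔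
    ∀ f g : CF d, IsTest f → IsTest g → Tendsto (fun n : ℕ => (∑' p, PP (N ^ J) φ φt f g p) +
      ∑ m ∈ Finset.range n, ∑' p, PP (N ^ (J + (m : ℤ))) ψ ψt f g p) atTop
      (𝓝 ((((2 * π) ^ d : ℝ) : ℂ) * ip f g)) := by
  have hu := isUnit_iff_ne_zero.mpr hNd
  constructor
  · intro H f g hf hg
    exact (H f g hf hg).2.2
  · intro H f g hf hg
    exact ⟨(key3 _ (hu.det_zpow J).ne_zero hφ hφt f g hf hg).summable,
      fun j _ => (key3 _ (hu.det_zpow j).ne_zero hψ hψt f g hf hg).summable, H f g hf hg⟩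

lemma dd_shift (hNd : N.det ≠ 0) (J i : ℤ)
    (H : ∀ f g : CF d, IsTest f → IsTest g → Tendsto (fun n : ℕ => (∑' p, PP (N ^ J) φ φt f g p) +
      ∑ m ∈ Finset.range n, ∑' p, PP (N ^ (J + (m : ℤ))) ψ ψt f g p) atTop
      (𝓝 ((((2 * π) ^ d : ℝ) : ℂ) * ip f g))) : 
    ∀ f g : CF d, IsTest f → IsTest g → Tendsto (fun n : ℕ => (∑' p, PP (N ^ (J + i)) φ φt f g p) +
      ∑ m ∈ Finset.range n, ∑' p, PP (N ^ (J + i + (m : ℤ))) ψ ψt f g p) atTop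
      (𝓝 ((((2 * π) ^ d : ℝ) : ℂ) * ip f g)) := by
  intro f g hf hg
  have hu := isUnit_iff_ne_zero.mpr hNd
  obtain ⟨f', hf', rfl⟩ := test_shift hNd hf i
  obtain ⟨g', hg', rfl⟩ := test_shift hNd hg i
  have h := (H f' g' hf' hg').const_mul ((|(N ^ i).det|⁻¹ : ℝ) : ℂ)
  rw [ip_scale _ (hu.det_zpow i).ne_zero, mul_left_comm]
  refine h.congr fun n => ?_
  rw [SS_scale hNd, mul_add, Finset.mul_sum]
  congr 1
  refine Finset.sum_congr rfl fun m _ => ?_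
  rw [add_right_comm, SS_scale hNd]

lemma dd_step (J : ℤ)
    (H : ∀ J : ℤ, ∀ f g : CF d, IsTest f → IsTest g → 
      Tendsto (fun n : ℕ => (∑' p, PP (N ^ J) φ φt f g p) +
      ∑ m ∈ Finset.range n, ∑' p, PP (N ^ (J + (m : ℤ))) ψ ψt f g p) atTop
      (𝓝 ((((2 * π) ^ d : ℝ) : ℂ) * ip f g))) (f g : CF d) (hf : IsTest f) (hg : IsTest g) :
    (∑' p, PP (N ^ J) φ φt f g p) + (∑' p, PP (N ^ J) ψ ψt f g p) = 
      ∑' p, PP (N ^ (J + 1)) φ φt f g p := by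
  have h1 := (tendsto_add_atTop_iff_nat 1).mpr (H J f g hf hg)
  have h2 := (H (J + 1) f g hf hg)
  have h3 := (h1.sub h2)
  rw [sub_self] at h3
  have h4 : Tendsto (fun _ : ℕ => (∑' p, PP (N ^ J) φ φt f g p) + (∑' p, PP (N ^ J) ψ ψt f g p) -
      ∑' p, PP (N ^ (J + 1)) φ φt f g p) atTop (𝓝 0) := by
    refine h3.congr fun n => ?_
    rw [Finset.sum_range_succ']
    have : ∀ m : ℕ, J + ((m + 1 : ℕ) : ℤ) = J + 1 + (m : ℤ) := fun m => by push_cast; ring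
    simp only [this, Nat.cast_zero, add_zero]
    ring
  exact sub_eq_zero.mp (tendsto_nhds_unique tendsto_const_nhds h4)

lemma telescope (f g : CF d) (J : ℤ) (H : ∀ J : ℤ,
    (∑' p, PP (N ^ J) φ φt f g p) + (∑' p, PP (N ^ J) ψ ψt f g p) = 
      ∑' p, PP (N ^ (J + 1)) φ φt f g p) (n : ℕ) :
    (∑' p, PP (N ^ J) φ φt f g p) +
      ∑ m ∈ Finset.range n, ∑' p, PP (N ^ (J + (m : ℤ))) ψ ψt f g p =
      ∑' p, PP (N ^ (J + (n : ℤ))) φ φt f g p := by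
  induction n with
  | zero => simp
  | succ n ih => 
    rw [Finset.sum_range_succ, ← add_assoc, ih, H, add_assoc]; simp

lemma step_all (hNd : N.det ≠ 0)
    (H : ∀ f g : CF d, IsTest f → IsTest g →
      (∑' p, PP 1 φ φt f g p) + (∑' p, PP 1 ψ ψt f g p) = ∑' p, PP N φ φt f g p)
    (f g : CF d) (hf : IsTest f) (hg : IsTest g) (J : ℤ) :
    (∑' p, PP (N ^ J) φ φt f g p) + (∑' p, PP (N ^ J) ψ ψt f g p) = 
      ∑' p, PP (N ^ (J + 1)) φ φt f g p := by
  obtain ⟨f', hf', rfl⟩ := test_shift hNd hf J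
  obtain ⟨g', hg', rfl⟩ := test_shift hNd hg J
  have h1 := SS_scale hNd φ φt f' g' J 0
  have h2 := SS_scale hNd ψ ψt f' g' J 0
  have h3 := SS_scale hNd φ φt f' g' J 1
  rw [zero_add, zpow_zero] at h1 h2
  rw [add_comm, zpow_one] at h3
  rw [h1, h2, h3, ← mul_add, H f' g' hf' hg']

lemma all_iff (hNd : N.det ≠ 0) :
    (∀ J : ℤ, ∀ f g : CF d, IsTest f → IsTest g → 
      Tendsto (fun n : ℕ => (∑' p, PP (N ^ J) φ φt f g p) +
      ∑ m ∈ Finset.range n, ∑' p, PP (N ^ (J + (m : ℤ))) ψ ψt f g p) atTop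
      (𝓝 ((((2 * π) ^ d : ℝ) : ℂ) * ip f g))) ↔
    (∀ f g : CF d, IsTest f → IsTest g →
      Tendsto (fun j : ℤ => ∑' p, PP (N ^ j) φ φt f g p) atTop
        (𝓝 ((((2 * π) ^ d : ℝ) : ℂ) * ip f g)) ∧
      (∑' p, PP 1 φ φt f g p) + (∑' p, PP 1 ψ ψt f g p) = ∑' p, PP N φ φt f g p) := by
  constructor
  · intro H f g hf hg
    have hs := fun J => dd_step J H f g hf hg
    constructor
    · rw [← Nat.map_cast_int_atTop, tendsto_map'_iff]
      refine (H 0 f g hf hg).congr fun n => ?_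
      rw [telescope f g 0 hs n, zero_add]; rfl
    · have := hs 0
      rwa [zero_add, zpow_zero, zpow_one] at this
  · intro H J f g hf hg
    have hs := step_all hNd (fun f g hf hg => (H f g hf hg).2) f g hf hg
    have : Tendsto (fun n : ℕ => J + (n : ℤ)) atTop atTop :=
      tendsto_atTop_add_const_left _ _ tendsto_natCast_atTop_atTop
    refine ((H f g hf hg).1.comp this).congr fun n => ?_
    rw [telescope f g J hs n]; rfl

end fin


/-- characterization of pairs of frequency-based nonhomogeneous dual
`N`-wavelet frames in the distribution space, `N = (Mᵀ)⁻¹` with `M` expansive. -/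
theorem statement16 {d : ℕ} (M : Matrix (Fin d) (Fin d) ℝ) (hM : Expansive M)
    (N : Matrix (Fin d) (Fin d) ℝ) (hNdef : N = (M.transpose)⁻¹)
    {r s : ℕ} (φ φt : Fin r → CF d) (ψ ψt : Fin s → CF d)
    (hφ : ∀ ℓ, LocL2 (φ ℓ)) (hφt : ∀ ℓ, LocL2 (φt ℓ))
    (hψ : ∀ ℓ, LocL2 (ψ ℓ)) (hψt : ∀ ℓ, LocL2 (ψt ℓ)) :
    ((∃ J : ℤ, DualDistr (fun j : ℤ => N ^ j) J φ φt
        (fun _ : ℤ => ψ) (fun _ : ℤ => ψt)) ↔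
     (∀ J : ℤ, DualDistr (fun j : ℤ => N ^ j) J φ φt
        (fun _ : ℤ => ψ) (fun _ : ℤ => ψt))) ∧
    ((∃ J : ℤ, DualDistr (fun j : ℤ => N ^ j) J φ φt
        (fun _ : ℤ => ψ) (fun _ : ℤ => ψt)) ↔
     (∀ f g : CF d, IsTest f → IsTest g →
        Tendsto (fun j : ℤ => ∑' p : Fin r × (Fin d → ℤ),
            ip f (fdil (N ^ j) p.2 (φ p.1)) * ip (fdil (N ^ j) p.2 (φt p.1)) g)
          atTop (𝓝 ((((2 * π) ^ d : ℝ) : ℂ) * ip f g)) ∧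
        (∑' p : Fin r × (Fin d → ℤ),
            ip f (fdil 1 p.2 (φ p.1)) * ip (fdil 1 p.2 (φt p.1)) g)
          + (∑' p : Fin s × (Fin d → ℤ),
              ip f (fdil 1 p.2 (ψ p.1)) * ip (fdil 1 p.2 (ψt p.1)) g)
          = ∑' p : Fin r × (Fin d → ℤ),
              ip f (fdil N p.2 (φ p.1)) * ip (fdil N p.2 (φt p.1)) g)) ∧
    ((∃ J : ℤ, DualDistr (fun j : ℤ => N ^ j) J φ φt
        (fun _ : ℤ => ψ) (fun _ : ℤ => ψt)) ↔
     ((∀ h : CF d, IsTest h →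
        Tendsto (fun j : ℤ =>
            ∫ ξ, (∑ ℓ : Fin r, (starRingEnd ℂ) (φ ℓ ((N ^ j).mulVec ξ)) *
                φt ℓ ((N ^ j).mulVec ξ)) * (starRingEnd ℂ) (h ξ))
          atTop (𝓝 (∫ ξ, (starRingEnd ℂ) (h ξ)))) ∧
      (∀ k : Fin d → ℝ,
        ((∀ i, ∃ m : ℤ, k i = (m : ℝ)) ∨
         (∃ m : Fin d → ℤ, k = M.transpose.mulVec (iv m))) →
        ∀ᵐ ξ : Fin d → ℝ,
          Ipair φ φt k ξ + Ipair ψ ψt k ξ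
            = Ipair φ φt (N.mulVec k) (N.mulVec ξ)))) := by
  have hMd := expansive_det hM
  have hNd : N.det ≠ 0 := by
    rw [hNdef, Matrix.det_nonsing_inv, Matrix.det_transpose, Ring.inverse_eq_inv']
    exact inv_ne_zero hMd
  have hii : (∃ J : ℤ, DualDistr (fun j : ℤ => N ^ j) J φ φt
        (fun _ : ℤ => ψ) (fun _ : ℤ => ψt)) ↔
     (∀ J : ℤ, DualDistr (fun j : ℤ => N ^ j) J φ φt
        (fun _ : ℤ => ψ) (fun _ : ℤ => ψt)) := by
    simp only [dd_iff hNd hφ hφt hψ hψt]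
    constructor
    · rintro ⟨J, H⟩ J'
      have := dd_shift hNd J (J' - J) H
      rwa [add_sub_cancel] at this
    · intro H
      exact ⟨0, H 0⟩
  have hiii := all_iff (φ := φ) (φt := φt) (ψ := ψ) (ψt := ψt) hNd
  have hall : (∀ J : ℤ, DualDistr (fun j : ℤ => N ^ j) J φ φt
        (fun _ : ℤ => ψ) (fun _ : ℤ => ψt)) ↔ _ :=
    (forall_congr' (dd_iff hNd hφ hφt hψ hψt)).trans hiii
  have p1 := part1 hM hNdef hNd hφ hφt
  have p2 := part2 hMd hNdef hNd hφ hφt hψ hψt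
  refine ⟨hii, hii.trans hall, (hii.trans hall).trans ?_⟩
  rw [← p1, ← p2]
  exact ⟨fun H => ⟨fun f g hf hg => (H f g hf hg).1, fun f g hf hg => (H f g hf hg).2⟩,
    fun H f g hf hg => ⟨H.1 f g hf hg, H.2 f g hf hg⟩⟩
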